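/- In any groupoid satisfying the medial law (M1) (xy)(zt)=(xz)(yt), the identity (M2) (xy)(zt)=(ty)(zx), and (xy²)y² = x, the identities (M3) ((xy)z)t=((xt)z)y and (M4) (x(yz))t=(x(tz))y hold. -/

import Mathlib

theorem stmt_5 {M : Type*} (f : M → M → M)
    (hM1 : ∀ x y z t, f (f x y) (f z t) = f (f x z) (f y t))
    (hM2 : ∀ x y z t, f (f x y) (f z t) = f (f t y) (f z x))
    (hsq : ∀ x y, f (f x (f y y)) (f y y) = x) :
    (∀ x y z t, f (f (f x y) z) t = f (f (f x t) z) y) ∧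
    (∀ x y z t, f (f x (f y z)) t = f (f x (f t z)) y) := by
  constructor
  · intro x y z t
    have key : ∀ y t, f (f (f x y) z) t
        = f (f (f x y) (f t (f x x))) (f z (f x x)) := by
      intro y t
      have h := hM1 (f x y) z (f t (f x x)) (f x x)
      rwa [hsq] at h
    rw [key y t, key t y, hM1 x y t (f x x)]
  · intro x y z t
    have key : ∀ y t, f (f x (f y z)) t
        = f (f (f (f x (f x x)) t) (f y z)) (f (f (f x x) (f x x)) (f x x)) := by
      intro y t
      have h := hM1 x (f y z) (f t (f x x)) (f x x)
      rw [hsq] at h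
      have h2 := hM1 (f x (f x x)) (f x x) t (f x x)
      rw [hsq] at h2
      rw [h, h2, hM1]
    rw [key y t, key t y, hM1 (f x (f x x)) t y z]
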